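/- arXiv:1509.02880 — 6 statements merged into one kernel-verified Lean document; each statement's English description precedes it below -/
import Mathlib

section
/- Let 0 < κ < 1/2, H = κ + 1/2, and Γ_κ = ∫_ℝ (|v−1|^κ − |v|^κ)² dv. Then for all real u, v, ∫_ℝ (|s−u|^κ − |s|^κ)(|s−v|^κ − |s|^κ) ds = (Γ_κ/2)·(|u|^{2H} + |v|^{2H} − |u−v|^{2H}). In particular, the Wiener-integral kernels f_u(s) = |s−u|^κ − |s|^κ realize (up to the factor Γ_κ) the covariance of a fractional Brownian motion with Hurst parameter H. -/
open MeasureTheory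

/-- If `a, b ≥ 0` differ by at most `1`, then `a ^ κ` and `b ^ κ` differ by at most `m ^ (κ - 1)`
for any `0 < m ≤ max a b`. -/
lemma abs_rpow_sub_rpow_le_rpow {κ a b m : ℝ} (hκ0 : 0 ≤ κ) (hκ1 : κ ≤ 1) (ha : 0 ≤ a)
    (hb : 0 ≤ b) (hab : |a - b| ≤ 1) (hm : 0 < m) (hmax : m ≤ max a b) :
    |a ^ κ - b ^ κ| ≤ m ^ (κ - 1) := by
  wlog h : b ≤ a generalizing a b
  · rw [abs_sub_comm]
    exact this hb ha (by rwa [abs_sub_comm]) (by rwa [max_comm]) (le_of_not_ge h)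
  rw [max_eq_left h] at hmax
  have hapos : 0 < a := hm.trans_le hmax
  rw [abs_of_nonneg (sub_nonneg.2 (Real.rpow_le_rpow hb h hκ0))]
  rw [abs_of_nonneg (sub_nonneg.2 h)] at hab
  have hratio : b / a ≤ (b / a) ^ κ :=
    Real.self_le_rpow_of_le_one (by positivity) ((div_le_one hapos).2 h) hκ1
  have hpow : a ^ κ = a ^ (κ - 1) * a := by
    rw [Real.rpow_sub_one hapos.ne', div_mul_cancel₀ _ hapos.ne']
  have hlow : a ^ (κ - 1) * b ≤ b ^ κ := by
    calc a ^ (κ - 1) * b = a ^ κ * (b / a) := by rw [hpow]; field_simp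
      _ ≤ a ^ κ * (b / a) ^ κ := by gcongr
      _ = b ^ κ := by
        rw [← Real.mul_rpow ha (by positivity), mul_div_cancel₀ _ hapos.ne']
  calc a ^ κ - b ^ κ ≤ a ^ (κ - 1) * (a - b) := by rw [hpow]; linarith
    _ ≤ a ^ (κ - 1) * 1 := by gcongr
    _ ≤ m ^ (κ - 1) := by
      rw [mul_one]
      exact Real.rpow_le_rpow_of_nonpos hm hmax (by linarith)

lemma continuous_cusp_kernel {κ : ℝ} (hκ0 : 0 ≤ κ) (u : ℝ) :
    Continuous fun s : ℝ => |s - u| ^ κ - |s| ^ κ :=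
  ((continuous_id.sub continuous_const).abs.rpow_const fun _ => Or.inr hκ0).sub
    (continuous_abs.rpow_const fun _ => Or.inr hκ0)

lemma integrable_cusp_kernel_one_sq {κ : ℝ} (hκ0 : 0 ≤ κ) (hκ : κ < 1 / 2) :
    Integrable fun s : ℝ => (|s - 1| ^ κ - |s| ^ κ) ^ 2 := by
  have hdom : Integrable fun s : ℝ => (3⁻¹ : ℝ) ^ (2 * κ - 2) * (1 + ‖s‖) ^ (-(2 - 2 * κ)) :=
    (integrable_one_add_norm (by rw [Module.finrank_self]; norm_num; linarith)).const_mul _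
  refine hdom.mono' ((continuous_cusp_kernel hκ0 1).pow 2).aestronglyMeasurable
    (Filter.Eventually.of_forall fun s => ?_)
  have hmax : 3⁻¹ * (1 + |s|) ≤ max |s - 1| |s| := by
    rcases le_total (1 / 2) |s| with h | h
    · exact le_max_of_le_right (by linarith)
    · refine le_max_of_le_left ?_
      have h₁ := neg_le_abs (s - 1)
      have h₂ := le_abs_self s
      linarith
  have hdiff : |(|s - 1| - |s|)| ≤ 1 := by
    simpa using abs_abs_sub_abs_le_abs_sub (s - 1) s
  have hbound := abs_rpow_sub_rpow_le_rpow hκ0 (by linarith) (abs_nonneg (s - 1)) (abs_nonneg s)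
    hdiff (by positivity) hmax
  rw [Real.norm_of_nonneg (sq_nonneg _), ← sq_abs, Real.norm_eq_abs,
    show -(2 - 2 * κ) = 2 * κ - 2 by ring, ← Real.mul_rpow (by norm_num) (by positivity)]
  calc |(|s - 1| ^ κ - |s| ^ κ)| ^ 2 ≤ ((3⁻¹ * (1 + |s|)) ^ (κ - 1)) ^ 2 := by gcongr
    _ = (3⁻¹ * (1 + |s|)) ^ (2 * κ - 2) := by
      rw [← Real.rpow_mul_natCast (by positivity)]
      congr 1
      push_cast
      ring

lemma cusp_kernel_mul_sq {κ : ℝ} (u s : ℝ) :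
    (|u * s - u| ^ κ - |u * s| ^ κ) ^ 2 = (|u| ^ κ) ^ 2 * (|s - 1| ^ κ - |s| ^ κ) ^ 2 := by
  rw [show u * s - u = u * (s - 1) by ring, abs_mul, abs_mul,
    Real.mul_rpow (abs_nonneg _) (abs_nonneg _), Real.mul_rpow (abs_nonneg _) (abs_nonneg _)]
  ring

lemma integrable_cusp_kernel_sq {κ : ℝ} (hκ0 : 0 ≤ κ) (hκ : κ < 1 / 2) (u : ℝ) :
    Integrable fun s : ℝ => (|s - u| ^ κ - |s| ^ κ) ^ 2 := by
  rcases eq_or_ne u 0 with rfl | hu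
  · simp
  · rw [← integrable_comp_mul_left_iff _ hu]
    simp only [cusp_kernel_mul_sq]
    exact (integrable_cusp_kernel_one_sq hκ0 hκ).const_mul _

/-- Self-similarity of the squared norm of the cusp kernel. -/
lemma integral_cusp_kernel_sq {κ : ℝ} (hκ0 : 0 ≤ κ) (u : ℝ) :
    ∫ s : ℝ, (|s - u| ^ κ - |s| ^ κ) ^ 2 =
      |u| ^ (2 * κ + 1) * ∫ s : ℝ, (|s - 1| ^ κ - |s| ^ κ) ^ 2 := by
  rcases eq_or_ne u 0 with rfl | hu
  · simp [Real.zero_rpow (by linarith : 2 * κ + 1 ≠ 0)]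
  · have hscale := Measure.integral_comp_mul_left
      (fun s : ℝ => (|s - u| ^ κ - |s| ^ κ) ^ 2) u
    simp only [cusp_kernel_mul_sq, integral_const_mul, smul_eq_mul, abs_inv] at hscale
    have hupos : 0 < |u| := abs_pos.2 hu
    rw [eq_inv_mul_iff_mul_eq₀ hupos.ne'] at hscale
    rw [← hscale, Real.rpow_add_one hupos.ne', mul_comm 2 κ, Real.rpow_mul (abs_nonneg u),
      Real.rpow_two]
    ring

/-- For `0 < κ < 1/2`, `H = κ + 1/2` and `Γ_κ = ∫_ℝ (|v−1|^κ − |v|^κ)² dv`, for all real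
`u, v`, `∫_ℝ (|s−u|^κ − |s|^κ)(|s−v|^κ − |s|^κ) ds = (Γ_κ/2)(|u|^{2H} + |v|^{2H} − |u−v|^{2H})`:
the kernels `f_u(s) = |s−u|^κ − |s|^κ` realize (up to the factor `Γ_κ`) the covariance of a
fractional Brownian motion with Hurst parameter `H`. -/
theorem cusp_fbm_covariance (κ H : ℝ) (hκ0 : 0 < κ) (hκ : κ < 1/2) (hH : H = κ + 1/2)
    (u v : ℝ) :
    ∫ s : ℝ, (|s - u| ^ κ - |s| ^ κ) * (|s - v| ^ κ - |s| ^ κ) =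
      (∫ w : ℝ, (|w - 1| ^ κ - |w| ^ κ) ^ 2) / 2 *
        (|u| ^ (2 * H) + |v| ^ (2 * H) - |u - v| ^ (2 * H)) := by
  have hκ0' := hκ0.le
  have hu := integrable_cusp_kernel_sq hκ0' hκ u
  have hv := integrable_cusp_kernel_sq hκ0' hκ v
  have hshift (s : ℝ) : (|s - v - (u - v)| ^ κ - |s - v| ^ κ) ^ 2 =
      (|s - u| ^ κ - |s - v| ^ κ) ^ 2 := by
    rw [sub_sub_sub_cancel_right]
  have huv : Integrable fun s : ℝ => (|s - u| ^ κ - |s - v| ^ κ) ^ 2 := by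
    simpa only [hshift] using (integrable_cusp_kernel_sq hκ0' hκ (u - v)).comp_sub_right v
  have huv_eq : ∫ s : ℝ, (|s - u| ^ κ - |s - v| ^ κ) ^ 2 =
      ∫ s : ℝ, (|s - (u - v)| ^ κ - |s| ^ κ) ^ 2 := by
    rw [← integral_sub_right_eq_self (fun s : ℝ => (|s - (u - v)| ^ κ - |s| ^ κ) ^ 2) v]
    simp only [hshift]
  have hpolar (s : ℝ) : (|s - u| ^ κ - |s| ^ κ) * (|s - v| ^ κ - |s| ^ κ) =
      ((|s - u| ^ κ - |s| ^ κ) ^ 2 + (|s - v| ^ κ - |s| ^ κ) ^ 2 -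
        (|s - u| ^ κ - |s - v| ^ κ) ^ 2) / 2 := by
    ring
  simp only [hpolar]
  rw [integral_div, integral_sub (by exact hu.add hv) huv, integral_add hu hv, huv_eq,
    integral_cusp_kernel_sq hκ0' u, integral_cusp_kernel_sq hκ0' v,
    integral_cusp_kernel_sq hκ0' (u - v), show 2 * H = 2 * κ + 1 by rw [hH]; ring]
  ring
end

section
/- Let the signal be S(θ,t) = a|t−θ|^κ + h(θ,t) with a ≠ 0, κ ∈ (0,1/2), H = κ + 1/2, where h is continuous on ℝ × [0,T], continuously differentiable in θ, and |∂_θ h(θ,t)| ≤ L for all θ, t. Fix θ₀ ∈ (0,T) and u ∈ ℝ. Then, as ε → 0⁺, ε^{-2} ∫₀ᵀ (S(θ₀ + ε^{1/H} u, t) − S(θ₀, t))² dt → Γ² |u|^{2H}, where Γ² = a² ∫_ℝ (|v−1|^κ − |v|^κ)² dv. -/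
open MeasureTheory Filter

/-- Concavity estimate for power differences. -/
lemma abs_rpow_sub_rpow_le_mul_rpow {x y κ : ℝ} (hx : 0 ≤ x) (hy : 0 < y)
    (hκ0 : 0 ≤ κ) (hκ1 : κ ≤ 1) : |x ^ κ - y ^ κ| ≤ |x - y| * y ^ (κ - 1) := by
  have key : ∀ {p q : ℝ}, 0 < p → 0 ≤ q → q ≤ p → p ^ κ - q ^ κ ≤ (p - q) * p ^ (κ - 1) := by
    intro p q hp hq hqp
    have h1 : q / p ≤ (q / p) ^ κ :=
      Real.self_le_rpow_of_le_one (by positivity) (by rwa [div_le_one hp]) hκ1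
    have h2 : 0 < p ^ κ := Real.rpow_pos_of_pos hp κ
    rw [Real.div_rpow hq hp.le, le_div_iff₀ h2] at h1
    rw [Real.rpow_sub_one hp.ne']
    have h3 : (p - q) * (p ^ κ / p) = p ^ κ - q / p * p ^ κ := by field_simp
    rw [h3]
    linarith
  rcases le_total x y with hxy | hxy
  · have := Real.rpow_le_rpow hx hxy hκ0
    rw [abs_sub_comm, abs_sub_comm x, abs_of_nonneg (by linarith), abs_of_nonneg (by linarith)]
    exact key hy hx hxy
  · have := Real.rpow_le_rpow hy.le hxy hκ0
    rw [abs_of_nonneg (by linarith), abs_of_nonneg (by linarith)]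
    refine (key (hy.trans_le hxy) hy.le hxy).trans ?_
    exact mul_le_mul_of_nonneg_left
      (Real.rpow_le_rpow_of_nonpos hy hxy (by linarith)) (by linarith)

lemma abs_rpow_sub_rpow_le_rpow_abs_sub {x y κ : ℝ} (hx : 0 ≤ x) (hy : 0 ≤ y)
    (hκ0 : 0 ≤ κ) (hκ1 : κ ≤ 1) : |x ^ κ - y ^ κ| ≤ |x - y| ^ κ := by
  have key : ∀ {p q : ℝ}, 0 ≤ q → q ≤ p → p ^ κ - q ^ κ ≤ (p - q) ^ κ := by
    intro p q hq hqp
    have := Real.rpow_add_le_add_rpow (sub_nonneg.2 hqp) hq hκ0 hκ1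
    rw [sub_add_cancel] at this
    linarith
  rcases le_total x y with hxy | hxy
  · have := Real.rpow_le_rpow hx hxy hκ0
    rw [abs_sub_comm, abs_sub_comm x, abs_of_nonneg (by linarith), abs_of_nonneg (by linarith)]
    exact key hx hxy
  · have := Real.rpow_le_rpow hy hxy hκ0
    rw [abs_of_nonneg (by linarith), abs_of_nonneg (by linarith)]
    exact key hy hxy

/-- The cusp increment decays at infinity like `|v| ^ (κ - 1)`. -/
lemma abs_cusp_increment_le {κ : ℝ} (hκ0 : 0 ≤ κ) (hκ1 : κ ≤ 1) (u v : ℝ) :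
    |(|v - u| ^ κ - |v| ^ κ)| ≤
      (|u| + |u| ^ κ) * (2⁻¹ : ℝ) ^ (κ - 1) * (1 + |v|) ^ (κ - 1) := by
  have hd : |(|v - u| - |v|)| ≤ |u| := by
    simpa using abs_abs_sub_abs_le (v - u) v
  have hu : 0 ≤ |u| ^ κ := by positivity
  have hmono : ∀ y : ℝ, 0 < y → 2⁻¹ * (1 + |v|) ≤ y → y ^ (κ - 1) ≤
      (2⁻¹ : ℝ) ^ (κ - 1) * (1 + |v|) ^ (κ - 1) := by
    intro y hy hvy
    rw [← Real.mul_rpow (by norm_num) (by positivity)]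
    exact Real.rpow_le_rpow_of_nonpos (by positivity) hvy (by linarith)
  rw [mul_assoc]
  rcases le_total 1 |v| with hv | hv
  · have hv0 : 0 < |v| := by linarith
    calc _ ≤ |(|v - u| - |v|)| * |v| ^ (κ - 1) :=
          abs_rpow_sub_rpow_le_mul_rpow (abs_nonneg _) hv0 hκ0 hκ1
      _ ≤ (|u| + |u| ^ κ) * |v| ^ (κ - 1) := by gcongr; linarith
      _ ≤ _ := by
        gcongr
        exact hmono _ hv0 (by linarith)
  · calc _ ≤ |(|v - u| - |v|)| ^ κ :=
          abs_rpow_sub_rpow_le_rpow_abs_sub (abs_nonneg _) (abs_nonneg _) hκ0 hκ1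
      _ ≤ |u| ^ κ := by gcongr
      _ ≤ (|u| + |u| ^ κ) * (1 : ℝ) ^ (κ - 1) := by
        rw [Real.one_rpow]; linarith [abs_nonneg u]
      _ ≤ _ := by
        gcongr
        exact hmono _ one_pos (by linarith)

/-- Self-similarity of the squared cusp increment. -/
lemma integral_cusp_increment_sq {κ : ℝ} (hκ0 : 0 < κ) (u : ℝ) :
    ∫ v : ℝ, (|v - u| ^ κ - |v| ^ κ) ^ 2 =
      (∫ v : ℝ, (|v - 1| ^ κ - |v| ^ κ) ^ 2) * |u| ^ (2 * (κ + 1 / 2)) := by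
  rcases eq_or_ne u 0 with rfl | hu
  · rw [abs_zero, Real.zero_rpow (by positivity)]
    simp
  · have hu' : 0 < |u| := abs_pos.2 hu
    have h1 := Measure.integral_comp_mul_left (fun v : ℝ => (|v - u| ^ κ - |v| ^ κ) ^ 2) u
    have h2 : ∀ v : ℝ, (|u * v - u| ^ κ - |u * v| ^ κ) ^ 2 =
        (|u| ^ κ) ^ 2 * (|v - 1| ^ κ - |v| ^ κ) ^ 2 := by
      intro v
      rw [show u * v - u = u * (v - 1) by ring, abs_mul, abs_mul,
        Real.mul_rpow (abs_nonneg _) (abs_nonneg _), Real.mul_rpow (abs_nonneg _) (abs_nonneg _)]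
      ring
    simp_rw [h2] at h1
    rw [integral_const_mul, smul_eq_mul, abs_inv] at h1
    have h3 : |u| ^ (2 * (κ + 1 / 2)) = (|u| ^ κ) ^ 2 * |u| := by
      rw [show 2 * (κ + 1 / 2) = κ * (2 : ℕ) + 1 by push_cast; ring,
        Real.rpow_add_one hu'.ne', Real.rpow_mul_natCast hu'.le]
    rw [h3, mul_comm, mul_right_comm, h1]
    field_simp

/-- A squared difference of cusp signals, rescaled around the cusp. -/
lemma rescaled_integral_eq {κ ρ T θ₀ u a : ℝ} (hρ : 0 < ρ) (hT : 0 ≤ T) (h : ℝ → ℝ → ℝ) :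
    (ρ ^ (2 * (κ + 1 / 2)))⁻¹ * ∫ t in (0:ℝ)..T,
        ((a * |t - (θ₀ + ρ * u)| ^ κ + h (θ₀ + ρ * u) t) - (a * |t - θ₀| ^ κ + h θ₀ t)) ^ 2 =
      ∫ v : ℝ, ((fun v => θ₀ + ρ * v) ⁻¹' Set.Ioc 0 T).indicator
        (fun v => (a * (|v - u| ^ κ - |v| ^ κ) +
          (ρ ^ κ)⁻¹ * (h (θ₀ + ρ * u) (θ₀ + ρ * v) - h θ₀ (θ₀ + ρ * v))) ^ 2) v := by
  set F : ℝ → ℝ := fun t =>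
    ((a * |t - (θ₀ + ρ * u)| ^ κ + h (θ₀ + ρ * u) t) - (a * |t - θ₀| ^ κ + h θ₀ t)) ^ 2 with hF
  have hρκ : 0 < ρ ^ κ := Real.rpow_pos_of_pos hρ κ
  have h3 : ρ ^ (2 * (κ + 1 / 2)) = (ρ ^ κ) ^ 2 * ρ := by
    rw [show 2 * (κ + 1 / 2) = κ * (2 : ℕ) + 1 by push_cast; ring,
      Real.rpow_add_one hρ.ne', Real.rpow_mul_natCast hρ.le]
  rw [intervalIntegral.integral_of_le hT, ← integral_indicator measurableSet_Ioc]
  have h1 := Measure.integral_comp_mul_left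
    (fun s : ℝ => (Set.Ioc 0 T).indicator F (θ₀ + s)) ρ
  rw [integral_add_left_eq_self (fun s => (Set.Ioc 0 T).indicator F s) θ₀,
    abs_of_pos (inv_pos.2 hρ), smul_eq_mul] at h1
  rw [h3, mul_inv, mul_assoc, ← h1, ← integral_const_mul]
  refine integral_congr_ae (Eventually.of_forall fun v => ?_)
  by_cases hv : θ₀ + ρ * v ∈ Set.Ioc 0 T
  · have hv' : v ∈ (fun v => θ₀ + ρ * v) ⁻¹' Set.Ioc 0 T := hv
    simp only [Set.indicator_of_mem hv, Set.indicator_of_mem hv', hF]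
    rw [show θ₀ + ρ * v - (θ₀ + ρ * u) = ρ * (v - u) by ring,
      show θ₀ + ρ * v - θ₀ = ρ * v by ring, abs_mul, abs_mul, abs_of_pos hρ,
      Real.mul_rpow hρ.le (abs_nonneg _), Real.mul_rpow hρ.le (abs_nonneg _)]
    field_simp
    ring
  · have hv' : v ∉ (fun v => θ₀ + ρ * v) ⁻¹' Set.Ioc 0 T := hv
    simp only [Set.indicator_of_notMem hv, Set.indicator_of_notMem hv', mul_zero]

/-- The rescaled squared distances converge as the scale `ρ` tends to `0`. -/
lemma tendsto_rescaled_integral {a κ T L θ₀ u : ℝ} {h : ℝ → ℝ → ℝ}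
    (hκ0 : 0 < κ) (hκ : κ < 1 / 2) (hL : 0 ≤ L)
    (hcont : ContinuousOn (fun p : ℝ × ℝ => h p.1 p.2) (Set.univ ×ˢ Set.Icc 0 T))
    (hlip : ∀ θ θ' t, |h θ t - h θ' t| ≤ L * |θ - θ'|)
    (hθ₀ : θ₀ ∈ Set.Ioo 0 T) :
    Tendsto (fun ρ : ℝ => ∫ v : ℝ, ((fun v => θ₀ + ρ * v) ⁻¹' Set.Ioc 0 T).indicator
        (fun v => (a * (|v - u| ^ κ - |v| ^ κ) +
          (ρ ^ κ)⁻¹ * (h (θ₀ + ρ * u) (θ₀ + ρ * v) - h θ₀ (θ₀ + ρ * v))) ^ 2) v)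
      (nhdsWithin 0 (Set.Ioi 0))
      (nhds (∫ v : ℝ, (a * (|v - u| ^ κ - |v| ^ κ)) ^ 2)) := by
  have hT : 0 < T := hθ₀.1.trans hθ₀.2
  have hrem : ∀ ρ : ℝ, 0 < ρ → ∀ t,
      |(ρ ^ κ)⁻¹ * (h (θ₀ + ρ * u) t - h θ₀ t)| ≤ L * |u| * ρ ^ (1 - κ) := by
    intro ρ hρ t
    have h1 := hlip (θ₀ + ρ * u) θ₀ t
    rw [add_sub_cancel_left, abs_mul, abs_of_pos hρ] at h1
    have h2 : 0 < ρ ^ κ := Real.rpow_pos_of_pos hρ κ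
    rw [abs_mul, abs_of_pos (inv_pos.2 h2), Real.rpow_sub hρ, Real.rpow_one]
    calc _ ≤ (ρ ^ κ)⁻¹ * (L * (ρ * |u|)) := by gcongr
      _ = _ := by field_simp
  set K : ℝ := |a| * ((|u| + |u| ^ κ) * (2⁻¹ : ℝ) ^ (κ - 1)) + L * |u| * (1 + T) ^ (1 - κ) with hK
  refine tendsto_integral_filter_of_dominated_convergence
    (fun v : ℝ => K ^ 2 * (1 + ‖v‖) ^ (-(2 - 2 * κ))) ?_ ?_ ?_ ?_
  · filter_upwards with ρ
    have hm : Measurable fun v : ℝ => θ₀ + ρ * v := by fun_prop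
    have hS := hm (measurableSet_Ioc (a := (0:ℝ)) (b := T))
    rw [aestronglyMeasurable_indicator_iff hS]
    refine ContinuousOn.aestronglyMeasurable ?_ hS
    have hc : ∀ θ : ℝ, ContinuousOn (fun v : ℝ => h θ (θ₀ + ρ * v))
        ((fun v => θ₀ + ρ * v) ⁻¹' Set.Ioc 0 T) := by
      intro θ
      refine hcont.comp (f := fun v : ℝ => (θ, θ₀ + ρ * v)) (by fun_prop) ?_
      intro v hv
      exact ⟨Set.mem_univ _, Set.Ioc_subset_Icc_self hv⟩
    have hp : ∀ w : ℝ, Continuous fun v : ℝ => |v - w| ^ κ := fun w =>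
      (Real.continuous_rpow_const hκ0.le).comp (by fun_prop)
    have hp0 : Continuous fun v : ℝ => |v| ^ κ :=
      (Real.continuous_rpow_const hκ0.le).comp (by fun_prop)
    exact (((continuous_const.mul ((hp u).sub hp0)).continuousOn).add
      (continuousOn_const.mul ((hc _).sub (hc _)))).pow 2
  · filter_upwards [Ioo_mem_nhdsGT (zero_lt_one' ℝ)] with ρ hρ
    refine Eventually.of_forall fun v => ?_
    have hv1 : 0 < 1 + |v| := by positivity
    by_cases hv : v ∈ (fun v => θ₀ + ρ * v) ⁻¹' Set.Ioc 0 T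
    · rw [Set.indicator_of_mem hv, Real.norm_eq_abs, abs_pow, Real.norm_eq_abs]
      have hsq : (1 + |v|) ^ (-(2 - 2 * κ)) = ((1 + |v|) ^ (κ - 1)) ^ 2 := by
        rw [← Real.rpow_mul_natCast hv1.le]
        congr 1; push_cast; ring
      rw [hsq, ← mul_pow]
      gcongr
      have hv2 := hv.1
      have hv3 := hv.2
      have hρv : ρ * |v| ≤ T := by
        rw [← abs_of_pos hρ.1, ← abs_mul, abs_le]
        constructor <;> linarith [hθ₀.1, hθ₀.2]
      have hρ1 : ρ ≤ (1 + T) * (1 + |v|)⁻¹ := by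
        rw [← div_eq_mul_inv, le_div_iff₀ hv1]
        linarith [hρ.2]
      have hρ2 : ρ ^ (1 - κ) ≤ (1 + T) ^ (1 - κ) * (1 + |v|) ^ (κ - 1) := by
        refine (Real.rpow_le_rpow hρ.1.le hρ1 (by linarith)).trans_eq ?_
        rw [Real.mul_rpow (by positivity) (by positivity), Real.inv_rpow hv1.le,
          ← Real.rpow_neg hv1.le, neg_sub]
      calc _ ≤ |a * (|v - u| ^ κ - |v| ^ κ)| + _ := abs_add_le _ _
        _ ≤ |a| * ((|u| + |u| ^ κ) * (2⁻¹ : ℝ) ^ (κ - 1) * (1 + |v|) ^ (κ - 1)) +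
            L * |u| * ((1 + T) ^ (1 - κ) * (1 + |v|) ^ (κ - 1)) := by
          refine add_le_add ?_ ((hrem ρ hρ.1 _).trans ?_)
          · rw [abs_mul]
            gcongr
            exact abs_cusp_increment_le hκ0.le (by linarith) u v
          · gcongr
        _ = _ := by rw [hK]; ring
    · rw [Set.indicator_of_notMem hv, norm_zero]
      positivity
  · refine (integrable_one_add_norm ?_).const_mul _
    simp only [Module.finrank_self, Nat.cast_one]
    linarith
  · refine Eventually.of_forall fun v => ?_
    have h0 : Tendsto (fun ρ : ℝ => θ₀ + ρ * v) (nhdsWithin 0 (Set.Ioi 0)) (nhds θ₀) := by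
      have : Tendsto (fun ρ : ℝ => θ₀ + ρ * v) (nhds 0) (nhds (θ₀ + 0 * v)) :=
        Continuous.tendsto (by fun_prop) 0
      rw [zero_mul, add_zero] at this
      exact this.mono_left nhdsWithin_le_nhds
    have hmem := h0.eventually (Ioo_mem_nhds hθ₀.1 hθ₀.2)
    have hg : Tendsto (fun ρ : ℝ =>
        (ρ ^ κ)⁻¹ * (h (θ₀ + ρ * u) (θ₀ + ρ * v) - h θ₀ (θ₀ + ρ * v)))
        (nhdsWithin 0 (Set.Ioi 0)) (nhds 0) := by
      have h1 : Tendsto (fun ρ : ℝ => L * |u| * ρ ^ (1 - κ)) (nhdsWithin 0 (Set.Ioi 0))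
          (nhds 0) := by
        have h2 : Tendsto (fun ρ : ℝ => L * |u| * ρ ^ (1 - κ)) (nhds 0)
            (nhds (L * |u| * 0 ^ (1 - κ))) :=
          (continuous_const.mul (Real.continuous_rpow_const (by linarith))).tendsto 0
        rw [Real.zero_rpow (by linarith), mul_zero] at h2
        exact h2.mono_left nhdsWithin_le_nhds
      refine squeeze_zero_norm' ?_ h1
      filter_upwards [self_mem_nhdsWithin] with ρ hρ
      exact hrem ρ hρ _
    have hlim := (hg.const_add (a * (|v - u| ^ κ - |v| ^ κ))).pow 2
    rw [add_zero] at hlim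
    refine hlim.congr' ?_
    filter_upwards [hmem] with ρ hρ
    have : v ∈ (fun v => θ₀ + ρ * v) ⁻¹' Set.Ioc 0 T := Set.Ioo_subset_Ioc_self hρ
    rw [Set.indicator_of_mem this]

/-- For the cusp signal `S(θ,t) = a|t−θ|^κ + h(θ,t)` with `h` continuous on `ℝ × [0,T]`,
continuously differentiable in `θ` with bounded derivative, for fixed `θ₀ ∈ (0,T)` and
`u ∈ ℝ`, as `ε → 0⁺`,
`ε⁻² ∫₀ᵀ (S(θ₀ + ε^{1/H} u, t) − S(θ₀, t))² dt → Γ² |u|^{2H}`, where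
`Γ² = a² ∫_ℝ (|v−1|^κ − |v|^κ)² dv` and `H = κ + 1/2`. -/
theorem cusp_normalized_distance_limit (a κ H T L θ₀ u : ℝ) (h h' : ℝ → ℝ → ℝ)
    (ha : a ≠ 0) (hκ0 : 0 < κ) (hκ : κ < 1/2) (hH : H = κ + 1/2) (hT : 0 < T)
    (hcont : ContinuousOn (fun p : ℝ × ℝ => h p.1 p.2) (Set.univ ×ˢ Set.Icc 0 T))
    (hderiv : ∀ θ t, HasDerivAt (fun θ : ℝ => h θ t) (h' θ t) θ)
    (hcont' : ContinuousOn (fun p : ℝ × ℝ => h' p.1 p.2) (Set.univ ×ˢ Set.Icc 0 T))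
    (hL : ∀ θ t, |h' θ t| ≤ L)
    (hθ₀ : θ₀ ∈ Set.Ioo 0 T) :
    Tendsto
      (fun ε : ℝ => ε ^ (-2 : ℝ) *
        ∫ t in (0:ℝ)..T,
          ((a * |t - (θ₀ + ε ^ (1 / H) * u)| ^ κ + h (θ₀ + ε ^ (1 / H) * u) t)
            - (a * |t - θ₀| ^ κ + h θ₀ t)) ^ 2)
      (nhdsWithin 0 (Set.Ioi 0))
      (nhds ((a ^ 2 * ∫ v : ℝ, (|v - 1| ^ κ - |v| ^ κ) ^ 2) * |u| ^ (2 * H))) := by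
  subst hH
  have hL0 : 0 ≤ L := (abs_nonneg _).trans (hL 0 0)
  have hlip : ∀ θ θ' t, |h θ t - h θ' t| ≤ L * |θ - θ'| := fun θ θ' t =>
    convex_univ.norm_image_sub_le_of_norm_hasDerivWithin_le (f := fun θ => h θ t)
      (fun x _ => (hderiv x t).hasDerivWithinAt) (fun x _ => hL x t)
      (Set.mem_univ θ') (Set.mem_univ θ)
  have hscale : Tendsto (fun ε : ℝ => ε ^ (1 / (κ + 1 / 2))) (nhdsWithin 0 (Set.Ioi 0))
      (nhdsWithin 0 (Set.Ioi 0)) := by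
    refine tendsto_nhdsWithin_iff.2 ⟨?_, ?_⟩
    · have := (Real.continuous_rpow_const (q := 1 / (κ + 1 / 2)) (by positivity)).tendsto 0
      rw [Real.zero_rpow (by positivity)] at this
      exact this.mono_left nhdsWithin_le_nhds
    · filter_upwards [self_mem_nhdsWithin] with ε hε
      exact Real.rpow_pos_of_pos hε _
  have hlim := (tendsto_rescaled_integral (a := a) (u := u) hκ0 hκ hL0 hcont hlip hθ₀).comp hscale
  simp_rw [mul_pow a] at hlim
  rw [integral_const_mul, integral_cusp_increment_sq hκ0, ← mul_assoc] at hlim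
  refine hlim.congr' ?_
  filter_upwards [self_mem_nhdsWithin] with ε hε
  have hε0 : 0 < ε := hε
  rw [Function.comp_apply, ← rescaled_integral_eq (Real.rpow_pos_of_pos hε0 _) hT.le,
    ← Real.rpow_mul hε0.le, Real.rpow_neg hε0.le]
  congr 3
  field_simp
end

section
/- Let the signal be S(θ,t) = a|t−θ|^κ + h(θ,t) with a ≠ 0, κ ∈ (0,1/2), H = κ + 1/2, where h is continuous on ℝ × [0,T], continuously differentiable in θ, and |∂_θ h(θ,t)| ≤ L for all θ, t. Let 0 < α ≤ β < T, θ₀ ∈ [α,β], and assume the identifiability condition: for every θ ∈ [α,β] with θ ≠ θ₀, the functions S(θ,·) and S(θ₀,·) are not equal almost everywhere on [0,T]. Then there exists a constant μ > 0 such that Φ(θ,θ₀) ≥ μ |θ − θ₀|^{2H} for all θ ∈ [α,β], where Φ(θ,θ₀) = ∫₀ᵀ (S(θ,t) − S(θ₀,t))² dt. -/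
open MeasureTheory

/-- On `|t - θ₀| ≤ |θ - θ₀| / 4`, two power cusps centred at `θ` and `θ₀` differ by at least a
constant times `|θ - θ₀| ^ κ`. -/
lemma cusp_sub_cusp_lower_bound {κ θ θ₀ t : ℝ} (hκ : 0 < κ) (ht : |t - θ₀| ≤ |θ - θ₀| / 4) :
    ((3 / 4 : ℝ) ^ κ - (1 / 4 : ℝ) ^ κ) * |θ - θ₀| ^ κ ≤ |t - θ| ^ κ - |t - θ₀| ^ κ := by
  have hd : 0 ≤ |θ - θ₀| := abs_nonneg _
  have h3 : 3 / 4 * |θ - θ₀| ≤ |t - θ| := by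
    have := abs_sub_le θ t θ₀
    rw [abs_sub_comm θ t] at this
    linarith
  have hfar : (3 / 4 * |θ - θ₀|) ^ κ ≤ |t - θ| ^ κ :=
    Real.rpow_le_rpow (by positivity) h3 hκ.le
  have hnear : |t - θ₀| ^ κ ≤ (1 / 4 * |θ - θ₀|) ^ κ :=
    Real.rpow_le_rpow (abs_nonneg _) (by linarith) hκ.le
  rw [Real.mul_rpow (by norm_num) hd] at hfar hnear
  linarith

/-- A linear function is eventually dominated by a multiple of a power of exponent below one. -/
lemma exists_pos_forall_mul_le_mul_rpow {κ C : ℝ} (L : ℝ) (hκ : κ < 1) (hC : 0 < C) :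
    ∃ ε > 0, ∀ d, 0 < d → d < ε → L * d ≤ C * d ^ κ := by
  have hlim : ContinuousAt (fun d : ℝ => L * d ^ (1 - κ)) 0 :=
    (Real.continuousAt_rpow_const 0 (1 - κ) (Or.inr (by linarith))).const_mul L
  have hev : ∀ᶠ d in nhds (0 : ℝ), L * d ^ (1 - κ) < C := by
    apply hlim.eventually_lt_const
    change L * (0 : ℝ) ^ (1 - κ) < C
    rwa [Real.zero_rpow (by linarith), mul_zero]
  obtain ⟨ε, hε, H⟩ := Metric.eventually_nhds_iff.1 hev
  refine ⟨ε, hε, fun d hd hdε => ?_⟩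
  have h1 := H (y := d) (by rwa [Real.dist_eq, sub_zero, abs_of_pos hd])
  have h2 : d = d ^ (1 - κ) * d ^ κ := by
    rw [← Real.rpow_add hd, sub_add_cancel, Real.rpow_one]
  calc L * d = L * d ^ (1 - κ) * d ^ κ := by rw [mul_assoc, ← h2]
    _ ≤ C * d ^ κ := by gcongr

/-- A parametric interval integral of a function which is continuous on the closed strip depends
continuously on the parameter. -/
lemma continuous_intervalIntegral_of_continuousOn_strip {f : ℝ → ℝ → ℝ} {a b : ℝ} (hab : a ≤ b)
    (hf : ContinuousOn (fun p : ℝ × ℝ => f p.1 p.2) (Set.univ ×ˢ Set.Icc a b)) :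
    Continuous fun x => ∫ t in a..b, f x t := by
  have hproj : Continuous fun p : ℝ × ℝ => (p.1, (Set.projIcc a b hab p.2 : ℝ)) := by
    fun_prop
  have hext : Continuous fun p : ℝ × ℝ => f p.1 (Set.projIcc a b hab p.2) :=
    hf.comp_continuous hproj fun p => ⟨Set.mem_univ _, (Set.projIcc a b hab p.2).2⟩
  have heq : (fun x => ∫ t in a..b, f x t) =
      fun x => ∫ t in a..b, f x (Set.projIcc a b hab t) := by
    ext x
    refine intervalIntegral.integral_congr fun t ht => ?_
    rw [Set.uIcc_of_le hab] at ht
    simp only [Set.projIcc_of_mem hab ht]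
  rw [heq]
  exact intervalIntegral.continuous_parametric_intervalIntegral_of_continuous' hext a b

/-- The squared `L²` distance of two continuous functions which are not a.e. equal is positive. -/
lemma intervalIntegral_sq_sub_pos {f g : ℝ → ℝ} {a b : ℝ} (hab : a ≤ b)
    (hf : ContinuousOn f (Set.Icc a b)) (hg : ContinuousOn g (Set.Icc a b))
    (hne : ¬ f =ᵐ[volume.restrict (Set.Icc a b)] g) :
    0 < ∫ t in a..b, (f t - g t) ^ 2 := by
  have hint : IntegrableOn (fun t => (f t - g t) ^ 2) (Set.Icc a b) :=
    ((hf.sub hg).pow 2).integrableOn_Icc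
  rw [intervalIntegral.integral_of_le hab, ← integral_Icc_eq_integral_Ioc]
  refine lt_of_le_of_ne (integral_nonneg fun t => sq_nonneg _) fun h0 => hne ?_
  have := (integral_eq_zero_iff_of_nonneg (fun t => sq_nonneg (f t - g t)) hint).1 h0.symm
  filter_upwards [this] with t ht
  exact sub_eq_zero.1 (pow_eq_zero_iff two_ne_zero |>.1 ht)

/-- A lower bound for the integral of a nonnegative continuous function from a lower bound on a
subinterval. -/
lemma mul_le_intervalIntegral_of_le_on_Icc {f : ℝ → ℝ} {a b c d m : ℝ} (hac : a ≤ c) (hcd : c ≤ d)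
    (hdb : d ≤ b) (hf : ContinuousOn f (Set.Icc a b)) (h0 : ∀ t, 0 ≤ f t)
    (hm : ∀ t ∈ Set.Icc c d, m ≤ f t) :
    (d - c) * m ≤ ∫ t in a..b, f t := by
  have hab : a ≤ b := hac.trans (hcd.trans hdb)
  have hint : IntervalIntegrable f volume a b := hf.intervalIntegrable_of_Icc hab
  have hint' : IntervalIntegrable f volume c d :=
    (hf.mono (Set.Icc_subset_Icc hac hdb)).intervalIntegrable_of_Icc hcd
  calc (d - c) * m = ∫ _ in c..d, m := by simp
    _ ≤ ∫ t in c..d, f t :=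
      intervalIntegral.integral_mono_on hcd intervalIntegrable_const hint' hm
    _ ≤ ∫ t in a..b, f t :=
      intervalIntegral.integral_mono_interval hac hcd hdb (Filter.Eventually.of_forall h0) hint

/-- Lemma 1 of the paper: under the identifiability condition, there is `μ > 0` with
`Φ(θ,θ₀) ≥ μ |θ − θ₀|^{2H}` for all `θ ∈ [α,β]`, where
`Φ(θ,θ₀) = ∫₀ᵀ (S(θ,t) − S(θ₀,t))² dt`, `S(θ,t) = a|t−θ|^κ + h(θ,t)` and `H = κ + 1/2`. -/
theorem cusp_quadratic_minorization (a κ H T L α β θ₀ : ℝ) (h h' : ℝ → ℝ → ℝ)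
    (ha : a ≠ 0) (hκ0 : 0 < κ) (hκ : κ < 1/2) (hH : H = κ + 1/2)
    (hα : 0 < α) (hαβ : α ≤ β) (hβ : β < T)
    (hcont : ContinuousOn (fun p : ℝ × ℝ => h p.1 p.2) (Set.univ ×ˢ Set.Icc 0 T))
    (hderiv : ∀ θ t, HasDerivAt (fun θ : ℝ => h θ t) (h' θ t) θ)
    (hcont' : ContinuousOn (fun p : ℝ × ℝ => h' p.1 p.2) (Set.univ ×ˢ Set.Icc 0 T))
    (hL : ∀ θ t, |h' θ t| ≤ L)
    (hθ₀ : θ₀ ∈ Set.Icc α β)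
    (hident : ∀ θ ∈ Set.Icc α β, θ ≠ θ₀ →
      ¬ ((fun t : ℝ => a * |t - θ| ^ κ + h θ t)
          =ᵐ[volume.restrict (Set.Icc 0 T)] fun t : ℝ => a * |t - θ₀| ^ κ + h θ₀ t)) :
    ∃ μ > 0, ∀ θ ∈ Set.Icc α β,
      μ * |θ - θ₀| ^ (2 * H) ≤
        ∫ t in (0:ℝ)..T,
          ((a * |t - θ| ^ κ + h θ t) - (a * |t - θ₀| ^ κ + h θ₀ t)) ^ 2 := by
  have hT : 0 ≤ T := by linarith
  set S : ℝ → ℝ → ℝ := fun θ t => a * |t - θ| ^ κ + h θ t with hS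
  have hScont : ContinuousOn (fun p : ℝ × ℝ => S p.1 p.2) (Set.univ ×ˢ Set.Icc 0 T) := by
    have hcusp : Continuous fun p : ℝ × ℝ => a * |p.2 - p.1| ^ κ :=
      ((continuous_snd.sub continuous_fst).abs.rpow_const fun _ => Or.inr hκ0.le).const_mul a
    exact hcusp.continuousOn.add hcont
  have hSslice : ∀ θ, ContinuousOn (S θ) (Set.Icc 0 T) := fun θ =>
    hScont.comp (f := fun t : ℝ => (θ, t)) (by fun_prop) fun t ht => ⟨Set.mem_univ _, ht⟩
  have hΦcont : Continuous fun θ => ∫ t in (0 : ℝ)..T, (S θ t - S θ₀ t) ^ 2 := by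
    refine continuous_intervalIntegral_of_continuousOn_strip hT ((hScont.sub ?_).pow 2)
    exact (hSslice θ₀).comp continuousOn_snd fun p hp => hp.2
  have hhlip : ∀ θ t, |h θ t - h θ₀ t| ≤ L * |θ - θ₀| := fun θ t =>
    convex_univ.norm_image_sub_le_of_norm_hasDerivWithin_le (f := fun θ => h θ t)
      (fun x _ => (hderiv x t).hasDerivWithinAt) (fun x _ => hL x t)
      (Set.mem_univ θ₀) (Set.mem_univ θ)
  set c : ℝ := (3 / 4 : ℝ) ^ κ - (1 / 4 : ℝ) ^ κ with hc
  have hc0 : 0 < c := sub_pos.2 (Real.rpow_lt_rpow (by norm_num) (by norm_num) hκ0)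
  have ha0 : 0 < |a| := abs_pos.2 ha
  obtain ⟨ε, hε, hεL⟩ := exists_pos_forall_mul_le_mul_rpow (κ := κ) (C := |a| * c / 2) L
    (by linarith) (by positivity)
  set δ : ℝ := min ε (min α (T - β)) with hδ
  have hδ0 : 0 < δ := lt_min hε (lt_min hα (by linarith))
  have hlocal : ∀ θ, 0 < |θ - θ₀| → |θ - θ₀| < δ →
      (|a| * c / 2) ^ 2 / 2 * |θ - θ₀| ^ (2 * H) ≤ ∫ t in (0 : ℝ)..T, (S θ t - S θ₀ t) ^ 2 := by
    intro θ hd hdδ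
    set d := |θ - θ₀| with hd_def
    have hdε : d < ε := hdδ.trans_le (min_le_left _ _)
    have hdα : d < α := hdδ.trans_le ((min_le_right _ _).trans (min_le_left _ _))
    have hdT : d < T - β := hdδ.trans_le ((min_le_right _ _).trans (min_le_right _ _))
    have hpt : ∀ t ∈ Set.Icc (θ₀ - d / 4) (θ₀ + d / 4),
        (|a| * c / 2 * d ^ κ) ^ 2 ≤ (S θ t - S θ₀ t) ^ 2 := by
      intro t ht
      have hcusp := cusp_sub_cusp_lower_bound (θ := θ) hκ0
        (abs_sub_le_iff.2 ⟨by linarith [ht.2], by linarith [ht.1]⟩ : |t - θ₀| ≤ d / 4)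
      have hcusp' : |a| * (c * d ^ κ) ≤ |a * (|t - θ| ^ κ - |t - θ₀| ^ κ)| := by
        rw [abs_mul]
        exact mul_le_mul_of_nonneg_left (hcusp.trans (le_abs_self _)) ha0.le
      have hsplit : a * (|t - θ| ^ κ - |t - θ₀| ^ κ) =
          (S θ t - S θ₀ t) - (h θ t - h θ₀ t) := by
        simp only [hS]; ring
      have htri := abs_sub (S θ t - S θ₀ t) (h θ t - h θ₀ t)
      rw [← hsplit] at htri
      have hlow : |a| * c / 2 * d ^ κ ≤ |S θ t - S θ₀ t| := by
        linarith [hhlip θ t, hεL d hd hdε]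
      rw [← sq_abs (S θ t - S θ₀ t)]
      gcongr
    have hmain := mul_le_intervalIntegral_of_le_on_Icc (a := 0) (b := T)
      (by linarith [hθ₀.1]) (by linarith) (by linarith [hθ₀.2])
      (((hSslice θ).sub (hSslice θ₀)).pow 2) (fun t => sq_nonneg _) hpt
    refine le_trans (le_of_eq ?_) hmain
    have hpow : d ^ (2 * H) = (d ^ κ) ^ 2 * d := by
      rw [hH, show 2 * (κ + 1 / 2) = κ + κ + 1 by ring, Real.rpow_add hd, Real.rpow_add hd,
        Real.rpow_one, sq]
    rw [hpow]
    ring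
  obtain ⟨m, hm, hfar⟩ : ∃ m > 0, ∀ θ ∈ Set.Icc α β, δ ≤ |θ - θ₀| →
      m ≤ ∫ t in (0 : ℝ)..T, (S θ t - S θ₀ t) ^ 2 := by
    have hK : IsCompact (Set.Icc α β ∩ {θ | δ ≤ |θ - θ₀|}) :=
      isCompact_Icc.inter_right (isClosed_le continuous_const (by fun_prop))
    refine hK.exists_forall_le' hΦcont.continuousOn (a := 0) ?_ |>.imp fun m hm =>
      ⟨hm.1, fun θ hθ hd => hm.2 θ ⟨hθ, hd⟩⟩
    rintro θ ⟨hθ, hd⟩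
    refine intervalIntegral_sq_sub_pos hT (hSslice θ) (hSslice θ₀) (hident θ hθ ?_)
    rintro rfl
    simp only [Set.mem_ofPred_eq, sub_self, abs_zero] at hd
    linarith
  have hT0 : 0 < T := by linarith
  refine ⟨min ((|a| * c / 2) ^ 2 / 2) (m / T ^ (2 * H)), by positivity, fun θ hθ => ?_⟩
  rcases (abs_nonneg (θ - θ₀)).eq_or_lt with hd | hd
  · rw [← hd, Real.zero_rpow (by linarith), mul_zero]
    exact intervalIntegral.integral_nonneg hT fun t _ => sq_nonneg _
  rcases lt_or_ge |θ - θ₀| δ with hdδ | hdδ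
  · refine le_trans ?_ (hlocal θ hd hdδ)
    gcongr
    exact min_le_left _ _
  · refine le_trans ?_ (hfar θ hθ hdδ)
    have hdT : |θ - θ₀| ≤ T :=
      abs_sub_le_iff.2 ⟨by linarith [hθ.2, hθ₀.1], by linarith [hθ.1, hθ₀.2]⟩
    calc min ((|a| * c / 2) ^ 2 / 2) (m / T ^ (2 * H)) * |θ - θ₀| ^ (2 * H)
        ≤ m / T ^ (2 * H) * T ^ (2 * H) := by
          gcongr
          · exact min_le_right _ _
          · linarith
      _ = m := div_mul_cancel₀ _ (by positivity)
end

section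
/- Let the signal be S(θ,t) = a|t−θ|^κ + h(θ,t) with a ≠ 0, κ ∈ (0,1/2), H = κ + 1/2, where h is continuous on ℝ × [0,T], continuously differentiable in θ, and |∂_θ h(θ,t)| ≤ L for all θ, t. Let θ₀ ∈ (0,T) and N > 0. Then there exists a constant C > 0 (depending only on a, κ, T, L) such that for every ε ∈ (0,1] and all u₁, u₂ with |u₁| ≤ N and |u₂| ≤ N, ε^{-2} ∫₀ᵀ (S(θ₀ + ε^{1/H} u₂, t) − S(θ₀ + ε^{1/H} u₁, t))² dt ≤ C(1+N) |u₂ − u₁|^{2H}. -/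
open MeasureTheory

/-- For a concave power, the increment is at most the slope of the chord from the origin to the
larger endpoint times the length. -/
lemma Real.abs_rpow_sub_rpow_le_mul_max_rpow {κ r s : ℝ} (hκ0 : 0 < κ) (hκ1 : κ ≤ 1)
    (hr : 0 ≤ r) (hs : 0 ≤ s) :
    |s ^ κ - r ^ κ| ≤ |s - r| * max s r ^ (κ - 1) := by
  wlog hrs : r ≤ s generalizing r s
  · rw [abs_sub_comm, abs_sub_comm s, max_comm]
    exact this hs hr (le_of_not_ge hrs)
  rcases hs.eq_or_lt with rfl | hs
  · obtain rfl : r = 0 := le_antisymm hrs hr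
    simp
  rw [max_eq_left hrs, abs_of_nonneg (sub_nonneg.2 hrs),
    abs_of_nonneg (sub_nonneg.2 (Real.rpow_le_rpow hr hrs hκ0.le)), Real.rpow_sub_one hs.ne']
  have h1 : r / s ≤ (r / s) ^ κ :=
    Real.self_le_rpow_of_le_one (by positivity) ((div_le_one hs).2 hrs) hκ1
  rw [Real.div_rpow hr hs.le, div_le_div_iff₀ hs (Real.rpow_pos_of_pos hs κ)] at h1
  rw [mul_div_assoc', le_div_iff₀ hs]
  linarith

lemma sq_abs_sub_rpow_sub_le {κ x y : ℝ} (hκ0 : 0 < κ) (hκ1 : κ ≤ 1) (hxy : x ≠ y) (t : ℝ) :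
    (|t - x| ^ κ - |t - y| ^ κ) ^ 2 ≤
      9 * |x - y| ^ (2 * κ) * (1 + ‖(t - x) / |x - y|‖) ^ (-(2 - 2 * κ)) := by
  have hΔ : 0 < |x - y| := abs_pos.2 (sub_ne_zero.2 hxy)
  have hdiff : |(|t - x| - |t - y|)| ≤ |x - y| := by
    have := abs_abs_sub_abs_le_abs_sub (t - x) (t - y)
    rwa [sub_sub_sub_cancel_left, abs_sub_comm y] at this
  have htri : |x - y| ≤ |t - x| + |t - y| := by
    simpa only [abs_sub_comm x t] using abs_sub_le x t y
  have hmax : (|t - x| + |x - y|) / 3 ≤ max |t - x| |t - y| := by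
    have := le_max_left |t - x| |t - y|
    have := le_max_right |t - x| |t - y|
    linarith
  have hpos : 0 < |t - x| + |x - y| := by positivity
  have hkey : |(|t - x| ^ κ - |t - y| ^ κ)| ≤
      3 * |x - y| * (|t - x| + |x - y|) ^ (κ - 1) := by
    calc |(|t - x| ^ κ - |t - y| ^ κ)|
        ≤ |(|t - x| - |t - y|)| * max |t - x| |t - y| ^ (κ - 1) :=
          Real.abs_rpow_sub_rpow_le_mul_max_rpow hκ0 hκ1 (abs_nonneg _) (abs_nonneg _)
      _ ≤ |x - y| * ((|t - x| + |x - y|) / 3) ^ (κ - 1) := by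
          refine mul_le_mul hdiff ?_ (by positivity) hΔ.le
          exact Real.rpow_le_rpow_of_nonpos (by positivity) hmax (by linarith)
      _ ≤ |x - y| * (3 * (|t - x| + |x - y|) ^ (κ - 1)) := by
          gcongr
          rw [Real.div_rpow hpos.le (by norm_num), div_eq_mul_inv, mul_comm,
            ← Real.rpow_neg (by norm_num)]
          gcongr
          calc (3 : ℝ) ^ (-(κ - 1)) ≤ 3 ^ (1 : ℝ) :=
                Real.rpow_le_rpow_of_exponent_le (by norm_num) (by linarith)
            _ = 3 := Real.rpow_one 3
      _ = _ := by ring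
  have hscale : 1 + ‖(t - x) / |x - y|‖ = (|t - x| + |x - y|) / |x - y| := by
    rw [Real.norm_eq_abs, abs_div, abs_abs]
    field_simp
    ring
  rw [← sq_abs]
  refine (pow_le_pow_left₀ (abs_nonneg _) hkey 2).trans_eq ?_
  rw [hscale, Real.div_rpow hpos.le hΔ.le, mul_pow, mul_pow, ← Real.rpow_mul_natCast hpos.le]
  have h1 : |x - y| ^ 2 = |x - y| ^ (2 * κ) / |x - y| ^ (-(2 - 2 * κ)) := by
    rw [← Real.rpow_sub hΔ, ← Real.rpow_natCast]
    congr 1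
    push_cast
    ring
  have h2 : (κ - 1) * ((2 : ℕ) : ℝ) = -(2 - 2 * κ) := by
    push_cast
    ring
  rw [h1, h2]
  ring

lemma integrable_one_add_norm_rpow_two_sub {κ : ℝ} (hκ : κ < 1 / 2) :
    Integrable fun v : ℝ => (1 + ‖v‖) ^ (-(2 - 2 * κ)) :=
  integrable_one_add_norm (by rw [Module.finrank_self]; push_cast; linarith)

/-- The squared `L²` distance on `[0, T]` between two perturbed cusps `a * |t - x| ^ κ + g₁ t` and
`a * |t - y| ^ κ + g₂ t`, when the perturbations differ by at most `B`. -/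
lemma integral_sq_cusp_add_sub_le {a κ x y T B : ℝ} {g₁ g₂ : ℝ → ℝ} (hκ0 : 0 < κ)
    (hκ : κ < 1 / 2) (hxy : x ≠ y) (hT : 0 ≤ T) (hg : ∀ t, |g₁ t - g₂ t| ≤ B) :
    ∫ t in (0 : ℝ)..T, ((a * |t - x| ^ κ + g₁ t) - (a * |t - y| ^ κ + g₂ t)) ^ 2 ≤
      18 * a ^ 2 * (∫ v : ℝ, (1 + ‖v‖) ^ (-(2 - 2 * κ))) * |x - y| ^ (2 * κ + 1) +
        2 * B ^ 2 * T := by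
  have hΔ : 0 < |x - y| := abs_pos.2 (sub_ne_zero.2 hxy)
  set w : ℝ → ℝ := fun v => (1 + ‖v‖) ^ (-(2 - 2 * κ)) with hw
  have hwi : Integrable w := integrable_one_add_norm_rpow_two_sub hκ
  have hwx : Integrable fun t => w ((t - x) / |x - y|) :=
    (hwi.comp_div hΔ.ne').comp_sub_right x
  have hw0 : ∀ v, 0 ≤ w v := fun v => by positivity
  have hint : Integrable (fun t => 18 * a ^ 2 * |x - y| ^ (2 * κ) * w ((t - x) / |x - y|)) :=
    hwx.const_mul _
  rw [intervalIntegral.integral_of_le hT]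
  calc ∫ t in Set.Ioc 0 T, ((a * |t - x| ^ κ + g₁ t) - (a * |t - y| ^ κ + g₂ t)) ^ 2
      ≤ ∫ t in Set.Ioc 0 T,
          (18 * a ^ 2 * |x - y| ^ (2 * κ) * w ((t - x) / |x - y|) + 2 * B ^ 2) := by
        refine integral_mono_of_nonneg (ae_of_all _ fun t => sq_nonneg _)
          (hint.integrableOn.add (integrable_const _)) (ae_of_all _ fun t => ?_)
        have h1 := mul_le_mul_of_nonneg_left
          (sq_abs_sub_rpow_sub_le hκ0 (by linarith) hxy t) (sq_nonneg a)
        have h2 : (g₁ t - g₂ t) ^ 2 ≤ B ^ 2 := sq_le_sq' (abs_le.1 (hg t)).1 (abs_le.1 (hg t)).2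
        have h3 := sq_nonneg (a * (|t - x| ^ κ - |t - y| ^ κ) - (g₁ t - g₂ t))
        simp only [hw]
        linarith
    _ = (∫ t in Set.Ioc 0 T, 18 * a ^ 2 * |x - y| ^ (2 * κ) * w ((t - x) / |x - y|)) +
          2 * B ^ 2 * T := by
        rw [integral_add hint.integrableOn (integrable_const _)]
        simp [hT, mul_comm]
    _ ≤ (∫ t, 18 * a ^ 2 * |x - y| ^ (2 * κ) * w ((t - x) / |x - y|)) + 2 * B ^ 2 * T := by
        gcongr
        · exact ae_of_all _ fun t => mul_nonneg (by positivity) (hw0 _)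
        · exact Measure.restrict_le_self
    _ = _ := by
        rw [integral_const_mul, integral_sub_right_eq_self (fun t => w (t / |x - y|)) x,
          Measure.integral_comp_div, abs_abs, smul_eq_mul, Real.rpow_add_one hΔ.ne']
        ring

/-- Deterministic content of Lemma 3 of the paper: there is a constant `C > 0` depending only
on `a, κ, T, L` such that for all `θ₀ ∈ (0,T)`, `N > 0`, `ε ∈ (0,1]` and `|u₁|, |u₂| ≤ N`,
`ε⁻² ∫₀ᵀ (S(θ₀ + ε^{1/H} u₂, t) − S(θ₀ + ε^{1/H} u₁, t))² dt ≤ C(1+N)|u₂ − u₁|^{2H}`,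
where `S(θ,t) = a|t−θ|^κ + h(θ,t)` and `H = κ + 1/2`. -/
theorem cusp_holder_bound (a κ H T L : ℝ) (h h' : ℝ → ℝ → ℝ)
    (ha : a ≠ 0) (hκ0 : 0 < κ) (hκ : κ < 1/2) (hH : H = κ + 1/2) (hT : 0 < T)
    (hcont : ContinuousOn (fun p : ℝ × ℝ => h p.1 p.2) (Set.univ ×ˢ Set.Icc 0 T))
    (hderiv : ∀ θ t, HasDerivAt (fun θ : ℝ => h θ t) (h' θ t) θ)
    (hcont' : ContinuousOn (fun p : ℝ × ℝ => h' p.1 p.2) (Set.univ ×ˢ Set.Icc 0 T))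
    (hL : ∀ θ t, |h' θ t| ≤ L) :
    ∃ C > 0, ∀ θ₀ ∈ Set.Ioo 0 T, ∀ N > 0, ∀ ε ∈ Set.Ioc (0:ℝ) 1, ∀ u₁ u₂ : ℝ,
      |u₁| ≤ N → |u₂| ≤ N →
      ε ^ (-2 : ℝ) *
        ∫ t in (0:ℝ)..T,
          ((a * |t - (θ₀ + ε ^ (1 / H) * u₂)| ^ κ + h (θ₀ + ε ^ (1 / H) * u₂) t)
            - (a * |t - (θ₀ + ε ^ (1 / H) * u₁)| ^ κ + h (θ₀ + ε ^ (1 / H) * u₁) t)) ^ 2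
        ≤ C * (1 + N) * |u₂ - u₁| ^ (2 * H) := by
  have hLip : ∀ x y t, |h x t - h y t| ≤ L * |x - y| := fun x y t =>
    convex_univ.norm_image_sub_le_of_norm_hasDerivWithin_le (f := fun θ => h θ t)
      (fun z _ => (hderiv z t).hasDerivWithinAt) (fun z _ => hL z t) trivial trivial
  set G : ℝ := ∫ v : ℝ, (1 + ‖v‖) ^ (-(2 - 2 * κ)) with hG
  have hG0 : 0 ≤ G := integral_nonneg fun v => by positivity
  refine ⟨18 * a ^ 2 * G + 4 * L ^ 2 * T + 1, by positivity, ?_⟩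
  rintro θ₀ - N hN ε ⟨hε0, hε1⟩ u₁ u₂ hu₁ hu₂
  rcases eq_or_ne u₂ u₁ with rfl | hu
  · simp only [sub_self, ne_eq, OfNat.ofNat_ne_zero, not_false_eq_true, zero_pow,
      intervalIntegral.integral_zero, mul_zero]
    positivity
  have hH0 : 0 < H := by linarith
  set δ : ℝ := ε ^ (1 / H) with hδ
  have hδ0 : 0 < δ := Real.rpow_pos_of_pos hε0 _
  have hδ1 : δ ≤ 1 := Real.rpow_le_one hε0.le hε1 (by positivity)
  have hεδ : ε ^ (-2 : ℝ) = δ ^ (-(2 * H)) := by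
    rw [hδ, ← Real.rpow_mul hε0.le]
    congr 1
    field_simp
  have hd : 0 < |u₂ - u₁| := abs_pos.2 (sub_ne_zero.2 hu)
  have hdist : |(θ₀ + δ * u₂) - (θ₀ + δ * u₁)| = δ * |u₂ - u₁| := by
    rw [add_sub_add_left_eq_sub, ← mul_sub, abs_mul, abs_of_pos hδ0]
  have hne : θ₀ + δ * u₂ ≠ θ₀ + δ * u₁ := fun he => hu (by simpa [hδ0.ne'] using he)
  have hbound := integral_sq_cusp_add_sub_le (a := a) hκ0 hκ hne hT.le
    (fun t => hLip (θ₀ + δ * u₂) (θ₀ + δ * u₁) t)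
  rw [hdist, ← hG, show 2 * κ + 1 = 2 * H by linarith, Real.mul_rpow hδ0.le hd.le] at hbound
  have hcancel : δ ^ (-(2 * H)) * δ ^ (2 * H) = 1 := by
    rw [← Real.rpow_add hδ0]
    simp
  have hδsq : δ ^ (-(2 * H)) * δ ^ 2 ≤ 1 := by
    rw [← Real.rpow_natCast, ← Real.rpow_add hδ0]
    exact Real.rpow_le_one hδ0.le hδ1 (by push_cast; linarith)
  have hdsq : |u₂ - u₁| ^ 2 ≤ 2 * (1 + N) * |u₂ - u₁| ^ (2 * H) := by
    have h2N : |u₂ - u₁| ≤ 1 + 2 * N := by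
      have := abs_sub u₂ u₁
      linarith
    have hsplit : |u₂ - u₁| ^ 2 = |u₂ - u₁| ^ (2 - 2 * H) * |u₂ - u₁| ^ (2 * H) := by
      rw [← Real.rpow_add hd, ← Real.rpow_natCast]
      congr 1
      push_cast
      ring
    rw [hsplit]
    gcongr
    calc |u₂ - u₁| ^ (2 - 2 * H) ≤ (1 + 2 * N) ^ (2 - 2 * H) :=
          Real.rpow_le_rpow hd.le h2N (by linarith)
      _ ≤ (1 + 2 * N) ^ (1 : ℝ) :=
          Real.rpow_le_rpow_of_exponent_le (by linarith) (by linarith)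
      _ ≤ 2 * (1 + N) := by
          rw [Real.rpow_one]
          linarith
  set D : ℝ := |u₂ - u₁| ^ (2 * H) with hD
  have hD0 : 0 ≤ D := by positivity
  rw [hεδ]
  calc _ ≤ δ ^ (-(2 * H)) * (18 * a ^ 2 * G * (δ ^ (2 * H) * D) +
          2 * (L * (δ * |u₂ - u₁|)) ^ 2 * T) := by gcongr
    _ = 18 * a ^ 2 * G * D * (δ ^ (-(2 * H)) * δ ^ (2 * H)) +
          2 * L ^ 2 * T * ((δ ^ (-(2 * H)) * δ ^ 2) * |u₂ - u₁| ^ 2) := by ring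
    _ ≤ 18 * a ^ 2 * G * D * 1 + 2 * L ^ 2 * T * (1 * (2 * (1 + N) * D)) := by
        rw [hcancel]
        gcongr
    _ ≤ (18 * a ^ 2 * G + 4 * L ^ 2 * T + 1) * (1 + N) * D := by
        have h1 : 0 ≤ 18 * a ^ 2 * G * (N * D) := by positivity
        have h2 : 0 ≤ (1 + N) * D := by positivity
        linarith
end

section
/- Let a ≠ 0, 0 < κ < 1/2, T > 0, and let S : [0,T] → ℝ be continuously differentiable. Define F(θ) = ∫₀ᵀ (a|t−θ|^κ − S(t))² dt for θ ∈ (0,T). Then F is differentiable on (0,T), and for each θ ∈ (0,T), F′(θ) = (a θ^κ − S(0))² − (a (T−θ)^κ − S(T))² − 2 ∫₀ᵀ (a|t−θ|^κ − S(t)) S′(t) dt. -/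
open MeasureTheory

/-- Differentiating the convolution of a continuous `g` with a continuously differentiable `S` over
an interval: integrating by parts moves the derivative from `g` onto `S`. -/
theorem hasDerivAt_integral_comp_sub_mul {T : ℝ} (hT : 0 ≤ T) {g S S' : ℝ → ℝ} (hg : Continuous g)
    (hS : ∀ t ∈ Set.Icc 0 T, HasDerivWithinAt S (S' t) (Set.Icc 0 T) t)
    (hS' : ContinuousOn S' (Set.Icc 0 T)) (θ : ℝ) :
    HasDerivAt (fun θ : ℝ => ∫ t in (0:ℝ)..T, g (t - θ) * S t)
      (g (-θ) * S 0 - g (T - θ) * S T + ∫ t in (0:ℝ)..T, g (t - θ) * S' t) θ := by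
  set G : ℝ → ℝ := fun x => ∫ u in (0:ℝ)..x, g u
  have hG : ∀ x, HasDerivAt G (g x) x := fun x => hg.integral_hasStrictDerivAt 0 x |>.hasDerivAt
  have hGc : Continuous G := continuous_iff_continuousAt.2 fun x => (hG x).continuousAt
  have hGsub : ∀ t x, HasDerivAt (fun x => G (t - x)) (-g (t - x)) x := fun t x =>
    (hG (t - x)).comp_const_sub t x
  have hSc : ContinuousOn S (Set.Icc 0 T) := fun t ht => (hS t ht).continuousWithinAt
  have hS'i : IntervalIntegrable S' volume 0 T :=
    ContinuousOn.intervalIntegrable (by rwa [Set.uIcc_of_le hT])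
  have hparts : ∀ x, ∫ t in (0:ℝ)..T, g (t - x) * S t =
      G (T - x) * S T - G (0 - x) * S 0 - ∫ t in (0:ℝ)..T, G (t - x) * S' t := fun x => by
    rw [intervalIntegral.integral_mul_deriv_eq_deriv_mul_of_hasDerivAt
      (u := fun t => G (t - x)) (u' := fun t => g (t - x)) (v := S) (v' := S')
      (by fun_prop) (by rwa [Set.uIcc_of_le hT])
      (fun t _ => (hG (t - x)).comp_sub_const t x)
      (fun t ht => by
        rw [min_eq_left hT, max_eq_right hT] at ht
        exact (hS t (Set.Ioo_subset_Icc_self ht)).hasDerivAt (Icc_mem_nhds ht.1 ht.2))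
      (Continuous.intervalIntegrable (by fun_prop) _ _) hS'i]
    ring
  obtain ⟨C, hC⟩ := (isCompact_Icc (a := -θ - 1) (b := T - θ + 1)).exists_bound_of_continuousOn
    hg.continuousOn
  have hint : HasDerivAt (fun x => ∫ t in (0:ℝ)..T, G (t - x) * S' t)
      (∫ t in (0:ℝ)..T, -g (t - θ) * S' t) θ := by
    refine (intervalIntegral.hasDerivAt_integral_of_dominated_loc_of_deriv_le
      (F := fun x t => G (t - x) * S' t) (F' := fun x t => -g (t - x) * S' t)
      (bound := fun t => C * ‖S' t‖)
      (Metric.ball_mem_nhds θ one_pos) (Filter.Eventually.of_forall fun x => ?_) ?_ ?_ ?_ ?_ ?_).2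
    · exact (hS'i.continuousOn_mul
        (Continuous.continuousOn (by fun_prop))).aestronglyMeasurable_restrict_uIoc
    · exact hS'i.continuousOn_mul (Continuous.continuousOn (by fun_prop))
    · exact (hS'i.continuousOn_mul
        (Continuous.continuousOn (by fun_prop))).aestronglyMeasurable_restrict_uIoc
    · refine Filter.Eventually.of_forall fun t ht x hx => ?_
      rw [Set.uIoc_of_le hT] at ht
      rw [Metric.mem_ball, Real.dist_eq, abs_lt] at hx
      rw [norm_mul, norm_neg]
      gcongr
      exact hC _ ⟨by linarith [ht.1, hx.2], by linarith [ht.2, hx.1]⟩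
    · exact hS'i.norm.const_mul C
    · exact Filter.Eventually.of_forall fun t _ x _ => (hGsub t x).mul_const _
  simp_rw [hparts]
  refine ((((hGsub T θ).mul_const (S T)).sub ((hGsub 0 θ).mul_const (S 0))).sub hint).congr_deriv ?_
  simp only [neg_mul, intervalIntegral.integral_neg, zero_sub]
  ring

/-- Derivative with respect to a translation parameter of the squared `L²(0,T)` distance between a
continuous `g` and a continuously differentiable `S`. -/
theorem hasDerivAt_integral_sq_comp_sub_sub {T : ℝ} (hT : 0 ≤ T) {g S S' : ℝ → ℝ}
    (hg : Continuous g) (hS : ∀ t ∈ Set.Icc 0 T, HasDerivWithinAt S (S' t) (Set.Icc 0 T) t)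
    (hS' : ContinuousOn S' (Set.Icc 0 T)) (θ : ℝ) :
    HasDerivAt (fun θ : ℝ => ∫ t in (0:ℝ)..T, (g (t - θ) - S t) ^ 2)
      ((g (-θ) - S 0) ^ 2 - (g (T - θ) - S T) ^ 2
        - 2 * ∫ t in (0:ℝ)..T, (g (t - θ) - S t) * S' t) θ := by
  have hSc : ContinuousOn S (Set.uIcc 0 T) := by
    rw [Set.uIcc_of_le hT]
    exact fun t ht => (hS t ht).continuousWithinAt
  have hS'c : ContinuousOn S' (Set.uIcc 0 T) := by rwa [Set.uIcc_of_le hT]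
  have hgS : ∀ x, IntervalIntegrable (fun t => g (t - x) * S t) volume 0 T := fun x =>
    ContinuousOn.intervalIntegrable (by fun_prop)
  have hgS' : IntervalIntegrable (fun t => g (t - θ) * S' t) volume 0 T :=
    ContinuousOn.intervalIntegrable (by fun_prop)
  have hSS' : IntervalIntegrable (fun t => S t * S' t) volume 0 T :=
    ContinuousOn.intervalIntegrable (by fun_prop)
  have hSS : IntervalIntegrable (fun t => S t ^ 2) volume 0 T :=
    ContinuousOn.intervalIntegrable (by fun_prop)
  have hgg : ∀ x, IntervalIntegrable (fun t => g (t - x) ^ 2) volume 0 T := fun x =>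
    Continuous.intervalIntegrable (by fun_prop) _ _
  have hexpand : ∀ x, ∫ t in (0:ℝ)..T, (g (t - x) - S t) ^ 2 =
      (∫ t in (0:ℝ)..T, g (t - x) ^ 2 * 1) - 2 * (∫ t in (0:ℝ)..T, g (t - x) * S t)
        + ∫ t in (0:ℝ)..T, S t ^ 2 := fun x => by
    simp only [mul_one]
    rw [← intervalIntegral.integral_const_mul, ← intervalIntegral.integral_sub (hgg x)
      ((hgS x).const_mul 2), ← intervalIntegral.integral_add ((hgg x).sub ((hgS x).const_mul 2)) hSS]
    congr 1
    ext t
    ring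
  have hsq := hasDerivAt_integral_comp_sub_mul (g := fun u => g u ^ 2) (S := fun _ => 1)
    (S' := fun _ => 0) hT (by fun_prop) (fun t _ => hasDerivWithinAt_const _ _ _)
    continuousOn_const θ
  have hprim : ∫ t in (0:ℝ)..T, S t * S' t = (S T ^ 2 - S 0 ^ 2) / 2 := by
    rw [intervalIntegral.integral_eq_sub_of_hasDerivAt_of_le hT (f := fun t => S t ^ 2 / 2)
      (by rw [← Set.uIcc_of_le hT]; fun_prop) (fun t ht => ?_) hSS']
    · ring
    · refine ((((hS t (Set.Ioo_subset_Icc_self ht)).hasDerivAt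
        (Icc_mem_nhds ht.1 ht.2)).pow 2).div_const 2).congr_deriv ?_
      push_cast
      ring
  simp_rw [hexpand]
  refine ((hsq.sub ((hasDerivAt_integral_comp_sub_mul hT hg hS hS' θ).const_mul 2)).add_const
    _).congr_deriv ?_
  simp only [sub_mul]
  rw [intervalIntegral.integral_sub hgS' hSS', hprim]
  simp only [mul_zero, intervalIntegral.integral_zero]
  ring

/-- Derivative of the Kullback–Leibler-type distance in the misspecification problem:
for `F(θ) = ∫₀ᵀ (a|t−θ|^κ − S(t))² dt` with `S` continuously differentiable on `[0,T]`,
`F′(θ) = (aθ^κ − S(0))² − (a(T−θ)^κ − S(T))² − 2∫₀ᵀ (a|t−θ|^κ − S(t)) S′(t) dt`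
for every `θ ∈ (0,T)`. -/
theorem misspecified_distance_deriv (a κ T : ℝ) (ha : a ≠ 0) (hκ0 : 0 < κ) (hκ : κ < 1/2)
    (hT : 0 < T) (S S' : ℝ → ℝ)
    (hS : ∀ t ∈ Set.Icc 0 T, HasDerivWithinAt S (S' t) (Set.Icc 0 T) t)
    (hS' : ContinuousOn S' (Set.Icc 0 T)) :
    ∀ θ ∈ Set.Ioo 0 T,
      HasDerivAt (fun θ : ℝ => ∫ t in (0:ℝ)..T, (a * |t - θ| ^ κ - S t) ^ 2)
        ((a * θ ^ κ - S 0) ^ 2 - (a * (T - θ) ^ κ - S T) ^ 2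
          - 2 * ∫ t in (0:ℝ)..T, (a * |t - θ| ^ κ - S t) * S' t) θ := by
  intro θ hθ
  have hg : Continuous fun u : ℝ => a * |u| ^ κ :=
    (continuous_abs.rpow_const fun _ => Or.inr hκ0.le).const_mul a
  have h := hasDerivAt_integral_sq_comp_sub_sub hT.le hg hS hS' θ
  rwa [abs_neg, abs_of_pos hθ.1, abs_of_pos (sub_pos.2 hθ.2)] at h
end

section
/- Let a ≠ 0, 0 < κ < 1/2, T > 0, and let S : [0,T] → ℝ be twice continuously differentiable. Define F(θ) = ∫₀ᵀ (a|t−θ|^κ − S(t))² dt for θ ∈ (0,T). Then F is twice differentiable on (0,T), and for each θ ∈ (0,T), F″(θ) = 2aκ θ^{κ−1}(a θ^κ − S(0)) + 2aκ (T−θ)^{κ−1}(a (T−θ)^κ − S(T)) + 2a (T−θ)^κ S′(T) − 2a θ^κ S′(0) − 2a ∫₀ᵀ |t−θ|^κ S″(t) dt. -/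
open MeasureTheory

theorem hasDerivAt_integral_comp_sub_mul_s14 {a b : ℝ} {P p g : ℝ → ℝ}
    (hP : ∀ u, HasDerivAt P (p u) u) (hp : Continuous p)
    (hg : ContinuousOn g (Set.uIcc a b)) (θ : ℝ) :
    HasDerivAt (fun θ : ℝ => ∫ t in a..b, P (t - θ) * g t)
      (-∫ t in a..b, p (t - θ) * g t) θ := by
  have hPc : Continuous P := continuous_iff_continuousAt.2 fun u => (hP u).continuousAt
  have hint : ∀ {q : ℝ → ℝ}, Continuous q → ∀ x : ℝ,
      IntervalIntegrable (fun t => q (t - x) * g t) volume a b := fun hq x =>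
    ContinuousOn.intervalIntegrable (by fun_prop)
  obtain ⟨C, hC⟩ := ((isCompact_uIcc (a := a) (b := b)).prod
    (isCompact_closedBall θ 1)).exists_bound_of_continuousOn
    (f := fun z : ℝ × ℝ => p (z.1 - z.2)) (by fun_prop)
  have key := intervalIntegral.hasDerivAt_integral_of_dominated_loc_of_deriv_le
    (μ := volume) (a := a) (b := b) (x₀ := θ) (s := Metric.closedBall θ 1)
    (F := fun x t => P (t - x) * g t) (F' := fun x t => -(p (t - x) * g t))
    (bound := fun t => C * |g t|)
    (Metric.closedBall_mem_nhds θ one_pos)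
    (Filter.Eventually.of_forall fun x => (hint hPc x).def'.aestronglyMeasurable)
    (hint hPc θ) (hint hp θ).neg.def'.aestronglyMeasurable
    (Filter.Eventually.of_forall fun t ht x hx => by
      rw [norm_neg, norm_mul, ← Real.norm_eq_abs]
      exact mul_le_mul_of_nonneg_right (hC (t, x) ⟨Set.uIoc_subset_uIcc ht, hx⟩) (norm_nonneg _))
    (ContinuousOn.intervalIntegrable (by fun_prop))
    (Filter.Eventually.of_forall fun t _ x _ => by
      have h := ((hP (t - x)).comp x ((hasDerivAt_id x).const_sub t)).mul_const (g t)
      exact h.congr_deriv (by ring))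
  simpa only [intervalIntegral.integral_neg] using key.2

/-- Differentiating `θ ↦ ∫ p(t − θ) f(t) dt` for `p` merely continuous: the derivative falls on `f`,
at the price of boundary terms. -/
theorem hasDerivAt_integral_translate_mul {a b : ℝ} {p f f' : ℝ → ℝ} (hp : Continuous p)
    (hf : ∀ t ∈ Set.uIcc a b, HasDerivWithinAt f (f' t) (Set.uIcc a b) t)
    (hf' : ContinuousOn f' (Set.uIcc a b)) (θ : ℝ) :
    HasDerivAt (fun θ : ℝ => ∫ t in a..b, p (t - θ) * f t)
      (p (a - θ) * f a - p (b - θ) * f b + ∫ t in a..b, p (t - θ) * f' t) θ := by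
  set P : ℝ → ℝ := fun u => ∫ s in (0 : ℝ)..u, p s
  have hP : ∀ u, HasDerivAt P (p u) u := fun u => hp.integral_hasStrictDerivAt 0 u |>.hasDerivAt
  have hparts : (fun θ : ℝ => ∫ t in a..b, p (t - θ) * f t) =
      fun θ => f b * P (b - θ) - f a * P (a - θ) - ∫ t in a..b, P (t - θ) * f' t := by
    funext x
    have h := intervalIntegral.integral_mul_deriv_eq_deriv_mul_of_hasDerivWithinAt
      (v := fun t => P (t - x)) (v' := fun t => p (t - x)) hf
      (fun t _ =>
        ((hP (t - x)).comp_sub_const t x).hasDerivWithinAt)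
      hf'.intervalIntegrable (Continuous.intervalIntegrable (by fun_prop) _ _)
    simpa only [mul_comm] using h
  rw [hparts]
  have hbd : ∀ c, HasDerivAt (fun x => f c * P (c - x)) (f c * -p (c - θ)) θ := fun c =>
    ((hP (c - θ)).comp_const_sub c θ).const_mul (f c)
  exact (((hbd b).sub (hbd a)).sub (hasDerivAt_integral_comp_sub_mul_s14 hP hp hf' θ)).congr_deriv
    (by ring)



/-- Second derivative of the Kullback–Leibler-type distance in the misspecification
problem: for `F(θ) = ∫₀ᵀ (a|t−θ|^κ − S(t))² dt` with `S` twice continuously differentiable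
on `[0,T]`, `F` is twice differentiable on `(0,T)` with
`F″(θ) = 2aκ θ^{κ−1}(aθ^κ − S(0)) + 2aκ(T−θ)^{κ−1}(a(T−θ)^κ − S(T))
  + 2a(T−θ)^κ S′(T) − 2aθ^κ S′(0) − 2a ∫₀ᵀ |t−θ|^κ S″(t) dt`. -/
theorem misspecified_distance_deriv2 (a κ T : ℝ) (ha : a ≠ 0) (hκ0 : 0 < κ) (hκ : κ < 1/2)
    (hT : 0 < T) (S S' S'' : ℝ → ℝ)
    (hS : ∀ t ∈ Set.Icc 0 T, HasDerivWithinAt S (S' t) (Set.Icc 0 T) t)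
    (hS' : ∀ t ∈ Set.Icc 0 T, HasDerivWithinAt S' (S'' t) (Set.Icc 0 T) t)
    (hS'' : ContinuousOn S'' (Set.Icc 0 T)) :
    ∃ F' : ℝ → ℝ, ∀ θ ∈ Set.Ioo 0 T,
      HasDerivAt (fun θ : ℝ => ∫ t in (0:ℝ)..T, (a * |t - θ| ^ κ - S t) ^ 2) (F' θ) θ ∧
      HasDerivAt F'
        (2 * a * κ * θ ^ (κ - 1) * (a * θ ^ κ - S 0)
          + 2 * a * κ * (T - θ) ^ (κ - 1) * (a * (T - θ) ^ κ - S T)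
          + 2 * a * (T - θ) ^ κ * S' T - 2 * a * θ ^ κ * S' 0
          - 2 * a * ∫ t in (0:ℝ)..T, |t - θ| ^ κ * S'' t) θ := by
  have hIcc : Set.uIcc 0 T = Set.Icc 0 T := Set.uIcc_of_le hT.le
  have hSc : ContinuousOn S (Set.Icc 0 T) := fun t ht => (hS t ht).continuousWithinAt
  have hSc' : ContinuousOn S' (Set.Icc 0 T) := fun t ht => (hS' t ht).continuousWithinAt
  have hcont : ∀ {r : ℝ}, 0 < r → Continuous fun u : ℝ => |u| ^ r := fun hr =>
    continuous_abs.rpow_const fun _ => Or.inr hr.le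
  have hpκ := hcont hκ0
  have h2κ : 0 < 2 * κ := by positivity
  have hp2κ := hcont h2κ
  rw [← hIcc] at hS hS' hS'' hSc hSc'
  have hexpand : (fun θ : ℝ => ∫ t in (0 : ℝ)..T, (a * |t - θ| ^ κ - S t) ^ 2) = fun θ =>
      a ^ 2 * (∫ t in (0 : ℝ)..T, |t - θ| ^ (2 * κ) * 1)
        - 2 * a * (∫ t in (0 : ℝ)..T, |t - θ| ^ κ * S t) + ∫ t in (0 : ℝ)..T, S t ^ 2 := by
    funext θ
    have hpow : ∀ t : ℝ, |t - θ| ^ (2 * κ) = (|t - θ| ^ κ) ^ 2 := fun t => by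
      rw [← Real.rpow_mul_natCast (abs_nonneg _), mul_comm κ]
      norm_num
    have hc : Continuous fun t : ℝ => |t - θ| ^ κ := hpκ.comp (continuous_id.sub continuous_const)
    have hsq : IntervalIntegrable (fun t : ℝ => a ^ 2 * (|t - θ| ^ κ) ^ 2) volume 0 T :=
      (continuous_const.mul (hc.pow 2)).intervalIntegrable 0 T
    have hcross : IntervalIntegrable (fun t : ℝ => 2 * a * (|t - θ| ^ κ * S t)) volume 0 T :=
      (continuousOn_const.mul (hc.continuousOn.mul hSc)).intervalIntegrable
    have hS2 : IntervalIntegrable (fun t => S t ^ 2) volume 0 T := (hSc.pow 2).intervalIntegrable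
    simp only [hpow, mul_one]
    rw [← intervalIntegral.integral_const_mul, ← intervalIntegral.integral_const_mul,
      ← intervalIntegral.integral_sub hsq hcross,
      ← intervalIntegral.integral_add (hsq.sub hcross) hS2]
    congr 1
    funext t
    ring
  refine ⟨fun θ => a ^ 2 * (θ ^ (2 * κ) - (T - θ) ^ (2 * κ))
    - 2 * a * (θ ^ κ * S 0 - (T - θ) ^ κ * S T + ∫ t in (0 : ℝ)..T, |t - θ| ^ κ * S' t), ?_⟩
  rintro θ ⟨hθ0, hθT⟩
  have hTθ : 0 < T - θ := sub_pos.2 hθT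
  have habs0 : |0 - θ| = θ := by rw [zero_sub, abs_neg, abs_of_pos hθ0]
  have habsT : |T - θ| = T - θ := abs_of_pos hTθ
  have hd0 : ∀ r : ℝ, HasDerivAt (fun x : ℝ => x ^ r) (r * θ ^ (r - 1)) θ := fun r =>
    Real.hasDerivAt_rpow_const (Or.inl hθ0.ne')
  have hdT : ∀ r : ℝ, HasDerivAt (fun x : ℝ => (T - x) ^ r) (-(r * (T - θ) ^ (r - 1))) θ :=
    fun r => by
      simpa using ((hasDerivAt_id θ).const_sub T).rpow_const (p := r) (Or.inl hTθ.ne')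
  constructor
  · rw [hexpand]
    have h1 := hasDerivAt_integral_translate_mul (a := 0) (b := T) (f := fun _ => (1 : ℝ))
      (f' := fun _ => 0) hp2κ (fun t _ => hasDerivWithinAt_const t _ 1) continuousOn_const θ
    have h2 := hasDerivAt_integral_translate_mul hpκ hS hSc' θ
    rw [habs0, habsT] at h1 h2
    exact (((h1.const_mul (a ^ 2)).sub (h2.const_mul (2 * a))).add_const
      (∫ t in (0 : ℝ)..T, S t ^ 2)).congr_deriv (by simp)
  · have h2 := hasDerivAt_integral_translate_mul hpκ hS' hS'' θ
    rw [habs0, habsT] at h2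
    have hsplit : ∀ {x : ℝ}, 0 < x → x ^ (2 * κ - 1) = x ^ (κ - 1) * x ^ κ := fun hx => by
      rw [← Real.rpow_add hx]
      ring_nf
    refine ((((hd0 (2 * κ)).sub (hdT (2 * κ))).const_mul (a ^ 2)).sub
      (((((hd0 κ).mul_const (S 0)).sub ((hdT κ).mul_const (S T))).add h2).const_mul
        (2 * a))).congr_deriv ?_
    rw [hsplit hθ0, hsplit hTθ]
    ring
end
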